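/- Let G be a finite simple chordal graph, w a vertex of G, and K ⊆ N(w) a clique. The valid inequality Σ_{u ∈ C_G(K∪{w})} y_{wu} + 2 Σ_{u ∈ K} y_{wu} ≤ 2 x_w defines a facet of the induced path polytope of G if and only if no connected component of the complement graph of the subgraph of G induced by C_G(K∪{w}) is bipartite. -/

import Mathlib

open SimpleGraph Finset
open scoped Classical

/-- A graph has a hole if some set of vertices induces a cycle of length at least 4. -/
def SimpleGraph.HasHole {V : Type*} (G : SimpleGraph V) : Prop :=
  ∃ (W : Set V) (n : ℕ), 4 ≤ n ∧ Nonempty (G.induce W ≃g SimpleGraph.cycleGraph n)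

/-- A graph is chordal if it has no hole. -/
def SimpleGraph.Chordal {V : Type*} (G : SimpleGraph V) : Prop := ¬ G.HasHole

/-- `W` induces a tree in `G`. -/
def SimpleGraph.IsInducedTree {V : Type*} (G : SimpleGraph V) (W : Finset V) : Prop :=
  (G.induce (W : Set V)).IsTree

/-- `W` induces a path in `G`. -/
def SimpleGraph.IsInducedPath {V : Type*} (G : SimpleGraph V) (W : Finset V) : Prop :=
  ∃ n : ℕ, 1 ≤ n ∧ Nonempty (G.induce (W : Set V) ≃g SimpleGraph.pathGraph n)

/-- The extended incidence vector of a vertex set `W`. -/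
noncomputable def SimpleGraph.xi {V : Type*} (G : SimpleGraph V) (W : Finset V) :
    (V → ℝ) × (Sym2 V → ℝ) :=
  (fun v => if v ∈ W then 1 else 0,
   fun e => if e ∈ G.edgeSet ∧ ∀ v ∈ e, v ∈ W then 1 else 0)

/-- `K` is a maximal clique of `G`. -/
def SimpleGraph.IsMaxCliqueF {V : Type*} (G : SimpleGraph V) (K : Finset V) : Prop :=
  G.IsClique (K : Set V) ∧ ∀ K' : Finset V, G.IsClique (K' : Set V) → K ⊆ K' → K' = K

/-- The induced tree cone `C_T(G)`. -/
noncomputable def SimpleGraph.inducedTreeCone {V : Type*} (G : SimpleGraph V) :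
    Set ((V → ℝ) × (Sym2 V → ℝ)) :=
  {p | (∀ v, 0 ≤ p.1 v) ∧ (∀ e, 0 ≤ p.2 e) ∧ (∀ e, e ∉ G.edgeSet → p.2 e = 0) ∧
    ∀ (v : V) (K : Finset V), G.IsMaxCliqueF K → v ∈ K →
      ∑ u ∈ K.erase v, p.2 s(u, v) ≤ p.1 v}

/-- The set of vertices outside `S` complete to `S`. -/
noncomputable def SimpleGraph.completeTo {V : Type*} [Fintype V] (G : SimpleGraph V)
    (S : Finset V) : Finset V :=
  Finset.univ.filter fun v => v ∉ S ∧ ∀ u ∈ S, G.Adj v u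

/-- The induced path cone `C_P(G)`. -/
noncomputable def SimpleGraph.inducedPathCone {V : Type*} [Fintype V] (G : SimpleGraph V) :
    Set ((V → ℝ) × (Sym2 V → ℝ)) :=
  {p | (∀ v, 0 ≤ p.1 v) ∧ (∀ e, 0 ≤ p.2 e) ∧ (∀ e, e ∉ G.edgeSet → p.2 e = 0) ∧
    ∀ (w : V) (K : Finset V), (K : Set V) ⊆ G.neighborSet w → G.IsClique (K : Set V) →
      ∑ u ∈ G.completeTo (insert w K), p.2 s(w, u) + 2 * ∑ u ∈ K, p.2 s(w, u) ≤ 2 * p.1 w}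

/-- The polytope `T(G)`: intersection of `C_T(G)` with the hyperplane `x(V) - y(E) = 1`. -/
noncomputable def SimpleGraph.treePolyT {V : Type*} [Fintype V] (G : SimpleGraph V) :
    Set ((V → ℝ) × (Sym2 V → ℝ)) :=
  {p ∈ G.inducedTreeCone | ∑ v : V, p.1 v - ∑ e : Sym2 V, p.2 e = 1}

/-- The polytope `P(G)`: intersection of `C_P(G)` with the hyperplane `x(V) - y(E) = 1`. -/
noncomputable def SimpleGraph.pathPolyP {V : Type*} [Fintype V] (G : SimpleGraph V) :
    Set ((V → ℝ) × (Sym2 V → ℝ)) :=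
  {p ∈ G.inducedPathCone | ∑ v : V, p.1 v - ∑ e : Sym2 V, p.2 e = 1}

/-- The induced tree polytope: convex hull of extended incidence vectors of induced trees. -/
noncomputable def SimpleGraph.inducedTreePolytope {V : Type*} (G : SimpleGraph V) :
    Set ((V → ℝ) × (Sym2 V → ℝ)) :=
  convexHull ℝ {p | ∃ W : Finset V, G.IsInducedTree W ∧ p = G.xi W}

/-- The induced path polytope: convex hull of extended incidence vectors of induced paths. -/
noncomputable def SimpleGraph.inducedPathPolytope {V : Type*} (G : SimpleGraph V) :
    Set ((V → ℝ) × (Sym2 V → ℝ)) :=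
  convexHull ℝ {p | ∃ W : Finset V, G.IsInducedPath W ∧ p = G.xi W}

/-- `p` is an extreme point of `s`: it cannot be written as the midpoint of two
distinct points of `s`. -/
def IsExtremePt {E : Type*} [AddCommGroup E] [Module ℝ E] (s : Set E) (p : E) : Prop :=
  p ∈ s ∧ ∀ q r : E, q ∈ s → r ∈ s → p = (2⁻¹ : ℝ) • (q + r) → q = r

/-- `u` is an extremity of the induced path `W` (degree at most 1 in the induced subgraph). -/
noncomputable def SimpleGraph.IsExtremity {V : Type*} (G : SimpleGraph V) (u : V)
    (W : Finset V) : Prop :=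
  u ∈ W ∧ (W.filter fun w => G.Adj u w).card ≤ 1

/-- The neighborhood of `v` as a `Finset`. -/
noncomputable def SimpleGraph.nbrF {V : Type*} [Fintype V] (G : SimpleGraph V) (v : V) :
    Finset V :=
  Finset.univ.filter fun u => G.Adj v u

/-- `K` defines an orbit of `w`. -/
noncomputable def SimpleGraph.DefinesOrbit {V : Type*} [Fintype V] (G : SimpleGraph V)
    (w : V) (K : Finset V) : Prop :=
  (K : Set V) ⊆ G.neighborSet w ∧ G.IsClique (K : Set V) ∧
    ¬ ∃ K' : Finset V, (K' : Set V) ⊆ G.neighborSet w ∧ G.IsClique (K' : Set V) ∧ K ⊂ K' ∧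
      insert w K ∪ G.completeTo (insert w K) ⊆ insert w K' ∪ G.completeTo (insert w K')
/-- The dimension of a set of points: the rank of its `vectorSpan` (i.e., the maximum
number of affinely independent points minus one). -/
noncomputable def setDim {E : Type*} [AddCommGroup E] [Module ℝ E] (s : Set E) : ℕ :=
  Module.finrank ℝ (vectorSpan ℝ s)


namespace SimpleGraph

section InducedPaths

variable {V : Type*} {G : SimpleGraph V}

lemma card_edgeFinset_pathGraph_succ (m : ℕ) : #(pathGraph (m + 1)).edgeFinset = m := by
  have h : (pathGraph (m + 1)).edgeFinset =
      univ.image fun i : Fin m => s(i.castSucc, i.succ) := by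
    ext e
    induction e using Sym2.ind with
    | _ a b =>
      simp only [mem_edgeFinset, mem_edgeSet, pathGraph_adj, mem_image, mem_univ, true_and,
        Sym2.eq_iff, Fin.ext_iff, Fin.val_castSucc, Fin.val_succ]
      constructor
      · rintro (h | h)
        · exact ⟨⟨a, by omega⟩, by simp [h]⟩
        · exact ⟨⟨b, by omega⟩, by simp [h]⟩
      · rintro ⟨i, hi⟩
        omega
  rw [h, card_image_of_injective, card_univ, Fintype.card_fin]
  intro i j hij
  simp only [Sym2.eq_iff, Fin.ext_iff, Fin.val_castSucc, Fin.val_succ] at hij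
  ext
  omega

lemma isInducedPath_image {n : ℕ} (hn : 1 ≤ n) (f : Fin n → V) (hf : Function.Injective f)
    (hadj : ∀ i j, G.Adj (f i) (f j) ↔ (pathGraph n).Adj i j) :
    G.IsInducedPath (univ.image f) := by
  let φ : pathGraph n ↪g G := ⟨⟨f, hf⟩, hadj _ _⟩
  refine ⟨n, hn, ?_⟩
  have h : ((univ.image f : Finset V) : Set V) = Set.range φ := by
    ext
    simp [φ]
  rw [h]
  exact ⟨φ.isoInduceRange.symm⟩

lemma isInducedPath_singleton (v : V) : G.IsInducedPath {v} := by
  have h := isInducedPath_image (G := G) le_rfl (fun _ : Fin 1 => v)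
    (Function.injective_of_subsingleton _)
    (by intro i j; fin_cases i; fin_cases j; simp)
  simpa using h

lemma isInducedPath_pair {u v : V} (h : G.Adj u v) : G.IsInducedPath {u, v} := by
  have h' := isInducedPath_image (G := G) one_le_two ![u, v]
    (by intro i j; fin_cases i <;> fin_cases j <;> simp [h.ne, h.ne'])
    (by intro i j; fin_cases i <;> fin_cases j <;> simp [pathGraph_adj, h, h.symm])
  convert h' using 1
  ext x
  simp [Fin.exists_fin_two, eq_comm]

lemma isInducedPath_triple {u v w : V} (huw : G.Adj w u) (hvw : G.Adj w v) (huv : ¬ G.Adj u v)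
    (hne : u ≠ v) : G.IsInducedPath {w, u, v} := by
  have hvu : ¬ G.Adj v u := fun h => huv h.symm
  have h' := isInducedPath_image (G := G) (show 1 ≤ 3 by norm_num) ![u, w, v]
    (by
      intro i j
      fin_cases i <;> fin_cases j <;>
        simp [huw.ne, huw.ne', hvw.ne, hvw.ne', hne, hne.symm])
    (by
      intro i j
      fin_cases i <;> fin_cases j <;>
        simp [pathGraph_adj, huw, huw.symm, hvw, hvw.symm, huv, hvu])
  convert h' using 1
  ext x
  simp [Fin.exists_fin_succ, eq_comm, or_left_comm]

variable {W : Finset V}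

lemma IsInducedPath.not_adj (hW : G.IsInducedPath W) {w u v : V} (hw : w ∈ W) (hu : u ∈ W)
    (hv : v ∈ W) (hwu : G.Adj w u) (hwv : G.Adj w v) : ¬ G.Adj u v := by
  obtain ⟨n, -, ⟨φ⟩⟩ := hW
  intro huv
  have key : ∀ x y : (W : Set V), G.Adj x y → (pathGraph n).Adj (φ x) (φ y) :=
    fun x y h => φ.map_rel_iff.2 h
  have h1 := key ⟨w, hw⟩ ⟨u, hu⟩ hwu
  have h2 := key ⟨w, hw⟩ ⟨v, hv⟩ hwv
  have h3 := key ⟨u, hu⟩ ⟨v, hv⟩ huv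
  rw [pathGraph_adj] at h1 h2 h3
  omega

lemma IsInducedPath.card_neighbors_le_two (hW : G.IsInducedPath W) {w : V} (hw : w ∈ W) :
    #{u ∈ W | G.Adj w u} ≤ 2 := by
  obtain ⟨n, -, ⟨φ⟩⟩ := hW
  let c : ℕ := φ ⟨w, hw⟩
  let f : V → ℕ := fun u => if hu : u ∈ W then φ ⟨u, hu⟩ else 0
  refine (card_le_card_of_injOn f (t := {c - 1, c + 1}) ?_ ?_).trans card_le_two
  · intro u hu
    simp only [coe_filter, Set.mem_ofPred_eq] at hu
    have h : (pathGraph n).Adj (φ ⟨w, hw⟩) (φ ⟨u, hu.1⟩) := φ.map_rel_iff.2 hu.2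
    rw [pathGraph_adj] at h
    simp only [f, hu.1, dif_pos, coe_insert, coe_singleton, Set.mem_insert_iff,
      Set.mem_singleton_iff, c]
    omega
  · intro u hu v hv huv
    simp only [coe_filter, Set.mem_ofPred_eq] at hu hv
    simp only [f, hu.1, hv.1, dif_pos] at huv
    simpa using φ.injective (Fin.ext huv)

/-- Euler's formula for induced paths: there is one more vertex than edges. -/
lemma IsInducedPath.sum_xi_sub_sum_xi [Fintype V] (hW : G.IsInducedPath W) :
    ∑ v, (G.xi W).1 v - ∑ e, (G.xi W).2 e = 1 := by
  obtain ⟨n, hn, ⟨φ⟩⟩ := hW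
  obtain ⟨m, rfl⟩ : ∃ m, n = m + 1 := ⟨n - 1, by omega⟩
  have hcard : #W = m + 1 := by
    have := Fintype.card_congr φ.toEquiv
    simpa using this
  have hedge : #(G.induce (W : Set V)).edgeFinset = m := by
    rw [φ.card_edgeFinset_eq, card_edgeFinset_pathGraph_succ]
  have hset : ∀ e, e ∈ (G.induce (W : Set V)).edgeFinset.map
      (Function.Embedding.subtype (· ∈ (W : Set V))).sym2Map ↔
        e ∈ G.edgeSet ∧ ∀ v ∈ e, v ∈ W := by
    intro e
    induction e using Sym2.ind with
    | _ a b =>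
      simp only [mem_map, mem_edgeFinset, Sym2.exists, mem_edgeSet, comap_adj,
        Function.Embedding.sym2Map_apply, Sym2.map_mk, Sym2.eq_iff, Sym2.mem_iff,
        Function.Embedding.subtype_apply, Subtype.exists, mem_coe]
      constructor
      · rintro ⟨x, hx, y, hy, hxy, ⟨rfl, rfl⟩ | ⟨rfl, rfl⟩⟩
        · exact ⟨hxy, by rintro v (rfl | rfl) <;> assumption⟩
        · exact ⟨hxy.symm, by rintro v (rfl | rfl) <;> assumption⟩
      · rintro ⟨hab, h⟩
        exact ⟨a, h a (.inl rfl), b, h b (.inr rfl), hab, .inl ⟨rfl, rfl⟩⟩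
  have h2 : ∑ e, (G.xi W).2 e = m := by
    simp only [xi, ← hset]
    rw [sum_ite_mem, univ_inter, sum_const, card_map, hedge, nsmul_one]
  have h1 : ∑ v, (G.xi W).1 v = m + 1 := by
    simp only [xi, sum_boole]
    simp [hcard]
  rw [h1, h2]
  ring

lemma xi_mem_inducedPathPolytope (hW : G.IsInducedPath W) : G.xi W ∈ G.inducedPathPolytope :=
  subset_convexHull _ _ ⟨W, hW, rfl⟩

/-- A linear inequality holds on the induced path polytope once it holds at all induced paths. -/
lemma map_le_of_mem_inducedPathPolytope (f : (V → ℝ) × (Sym2 V → ℝ) →ₗ[ℝ] ℝ) {r : ℝ}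
    (hf : ∀ W, G.IsInducedPath W → f (G.xi W) ≤ r) {p : (V → ℝ) × (Sym2 V → ℝ)}
    (hp : p ∈ G.inducedPathPolytope) : f p ≤ r := by
  have h : G.inducedPathPolytope ⊆ {p | f p ≤ r} := by
    refine convexHull_min ?_ (convex_halfSpace_le f.isLinear r)
    rintro _ ⟨W, hW, rfl⟩
    exact hf W hW
  exact h hp

end InducedPaths

section StarInequalities

variable {V : Type*} [Fintype V] {G : SimpleGraph V}

/-- The functional `x(V) - y(E)`. -/
noncomputable def eulerForm (V : Type*) [Fintype V] : (V → ℝ) × (Sym2 V → ℝ) →ₗ[ℝ] ℝ where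
  toFun p := ∑ v, p.1 v - ∑ e, p.2 e
  map_add' p q := by simp [sum_add_distrib]; ring
  map_smul' r p := by simp [mul_sum, mul_sub]

lemma eulerForm_eq_one {p : (V → ℝ) × (Sym2 V → ℝ)} (hp : p ∈ G.inducedPathPolytope) :
    eulerForm V p = 1 := by
  have h1 := map_le_of_mem_inducedPathPolytope (eulerForm V) (r := 1)
    (fun W hW => hW.sum_xi_sub_sum_xi.le) hp
  have h2 := map_le_of_mem_inducedPathPolytope (-eulerForm V) (r := -1)
    (fun W hW => neg_le_neg hW.sum_xi_sub_sum_xi.ge) hp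
  rw [LinearMap.neg_apply] at h2
  linarith

/-- The functional `∑ u, g u * y_{wu} - 2 * x_w`. -/
noncomputable def starForm (w : V) (g : V → ℝ) : (V → ℝ) × (Sym2 V → ℝ) →ₗ[ℝ] ℝ where
  toFun p := ∑ u, g u * p.2 s(w, u) - 2 * p.1 w
  map_add' p q := by simp [mul_add, sum_add_distrib]; ring
  map_smul' r p := by simp [mul_sub, mul_sum, mul_left_comm]

lemma starForm_apply (w : V) (g : V → ℝ) (p : (V → ℝ) × (Sym2 V → ℝ)) :
    starForm w g p = ∑ u, g u * p.2 s(w, u) - 2 * p.1 w := rfl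

lemma starForm_xi_of_notMem {w : V} (g : V → ℝ) {W : Finset V} (hw : w ∉ W) :
    starForm w g (G.xi W) = 0 := by
  simp [starForm_apply, xi, hw]

lemma starForm_xi_of_mem {w : V} (g : V → ℝ) {W : Finset V} (hw : w ∈ W) :
    starForm w g (G.xi W) = ∑ u ∈ W with G.Adj w u, g u - 2 := by
  have h : ∀ u, g u * (G.xi W).2 s(w, u) = if u ∈ W ∧ G.Adj w u then g u else 0 := by
    intro u
    simp [xi, hw, and_comm]
  rw [starForm_apply, sum_congr rfl fun u _ => h u, ← sum_filter]
  have h' : (univ.filter fun u => u ∈ W ∧ G.Adj w u) = W.filter fun u => G.Adj w u := by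
    ext
    simp
  simp [h', xi, hw]

/-- The star inequality with coefficients `g` is valid as soon as each coefficient is at most `2`
and the coefficients of two non-adjacent neighbors add up to at most `2`. -/
lemma starForm_nonpos {w : V} {g : V → ℝ} (hg : ∀ u, g u ≤ 2)
    (hg2 : ∀ u v, G.Adj w u → G.Adj w v → u ≠ v → ¬ G.Adj u v → g u + g v ≤ 2)
    {p : (V → ℝ) × (Sym2 V → ℝ)} (hp : p ∈ G.inducedPathPolytope) : starForm w g p ≤ 0 := by
  refine map_le_of_mem_inducedPathPolytope _ (fun W hW => ?_) hp
  by_cases hw : w ∈ W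
  · rw [starForm_xi_of_mem g hw]
    have hcard := hW.card_neighbors_le_two hw
    have hN : ∀ u ∈ W.filter (G.Adj w ·), u ∈ W ∧ G.Adj w u := fun u hu => by simpa using hu
    generalize W.filter (G.Adj w ·) = N at hcard hN
    interval_cases h : #N
    · rw [card_eq_zero.1 h]
      norm_num
    · obtain ⟨u, rfl⟩ := card_eq_one.1 h
      simpa using hg u
    · obtain ⟨u, v, huv, rfl⟩ := card_eq_two.1 h
      have hu := hN u (by simp)
      have hv := hN v (by simp)
      rw [sum_pair huv]
      linarith [hg2 u v hu.2 hv.2 huv (hW.not_adj hw hu.1 hv.1 hu.2 hv.2)]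
  · exact (starForm_xi_of_notMem g hw).le

end StarInequalities

end SimpleGraph

/-- For a set in an affine hyperplane off the origin, the dimension is one less than that of its
linear span. -/
lemma setDim_eq_finrank_span_sub_one {E : Type*} [AddCommGroup E] [Module ℝ E]
    [Module.Finite ℝ E] {s : Set E} (h : E →ₗ[ℝ] ℝ) (hs : ∀ p ∈ s, h p = 1) :
    setDim s = Module.finrank ℝ (Submodule.span ℝ s) - 1 := by
  rcases s.eq_empty_or_nonempty with rfl | ⟨p, hp⟩
  · rw [setDim, vectorSpan_empty, Submodule.span_empty, finrank_bot]
  have hker : vectorSpan ℝ s ≤ LinearMap.ker h := by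
    rw [vectorSpan_eq_span_vsub_set_right ℝ hp, Submodule.span_le]
    rintro _ ⟨q, hq, rfl⟩
    simp [hs q hq, hs p hp]
  have hp' : p ∉ vectorSpan ℝ s := fun hmem => by
    have := hker hmem
    simp [hs p hp] at this
  have hspan : Submodule.span ℝ s = vectorSpan ℝ s ⊔ Submodule.span ℝ {p} := by
    apply le_antisymm
    · rw [Submodule.span_le]
      intro q hq
      have := Submodule.add_mem_sup (vsub_mem_vectorSpan ℝ hq hp)
        (Submodule.mem_span_singleton_self (R := ℝ) p)
      simpa using this
    · refine sup_le ?_ (Submodule.span_mono (by simpa using hp))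
      rw [vectorSpan_eq_span_vsub_set_right ℝ hp, Submodule.span_le]
      rintro _ ⟨q, hq, rfl⟩
      exact Submodule.sub_mem _ (Submodule.subset_span hq) (Submodule.subset_span hp)
  rw [hspan, Submodule.finrank_sup_span_singleton hp', setDim, Nat.add_sub_cancel]

namespace SimpleGraph

section ExtendedIncidenceVectors

variable {V : Type*} {G : SimpleGraph V}

/-- The unit vector of the edge coordinate `e`. -/
noncomputable def edgeVec (e : Sym2 V) : (V → ℝ) × (Sym2 V → ℝ) := (0, Pi.single e 1)

lemma xi_singleton (v : V) : G.xi {v} = (Pi.single v 1, 0) := by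
  ext x
  · simp [xi, Pi.single_apply]
  · induction x using Sym2.ind with
    | _ a b =>
      have : ¬ (G.Adj a b ∧ a = v ∧ b = v) := by
        rintro ⟨h, rfl, rfl⟩
        exact h.ne rfl
      simp [xi, this]

lemma xi_pair {u v : V} (h : G.Adj u v) :
    G.xi {u, v} = G.xi {u} + G.xi {v} + edgeVec s(u, v) := by
  have hne := h.ne
  simp only [xi_singleton, edgeVec]
  ext x
  · simp only [xi, mem_insert, mem_singleton, Prod.fst_add, Pi.add_apply, Pi.single_apply,
      Pi.zero_apply]
    grind
  · induction x using Sym2.ind with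
    | _ a b =>
      simp only [xi, mem_insert, mem_singleton, Prod.snd_add, Pi.add_apply, Pi.single_apply,
        Pi.zero_apply, mem_edgeSet, Sym2.mem_iff, forall_eq_or_imp, forall_eq, Sym2.eq_iff]
      have := h.symm
      have hu := G.loopless.irrefl u
      have hv := G.loopless.irrefl v
      grind

lemma xi_triple {w u v : V} (hu : G.Adj w u) (hv : G.Adj w v) (huv : ¬ G.Adj u v) (hne : u ≠ v) :
    G.xi {w, u, v} =
      G.xi {w} + G.xi {u} + G.xi {v} + edgeVec s(w, u) + edgeVec s(w, v) := by
  have hwu := hu.ne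
  have hwv := hv.ne
  simp only [xi_singleton, edgeVec]
  ext x
  · simp only [xi, mem_insert, mem_singleton, Prod.fst_add, Pi.add_apply, Pi.single_apply,
      Pi.zero_apply]
    grind
  · induction x using Sym2.ind with
    | _ a b =>
      simp only [xi, mem_insert, mem_singleton, Prod.snd_add, Pi.add_apply, Pi.single_apply,
        Pi.zero_apply, mem_edgeSet, Sym2.mem_iff, forall_eq_or_imp, forall_eq, Sym2.eq_iff]
      have := hu.symm
      have := hv.symm
      have : ¬ G.Adj v u := fun h => huv h.symm
      have := G.loopless.irrefl u
      have := G.loopless.irrefl v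
      have := G.loopless.irrefl w
      grind

variable [Fintype V]

lemma map_xi_eq_zero (f : (V → ℝ) × (Sym2 V → ℝ) →ₗ[ℝ] ℝ) (hv : ∀ v, f (G.xi {v}) = 0)
    (he : ∀ e ∈ G.edgeSet, f (edgeVec e) = 0) (W : Finset V) : f (G.xi W) = 0 := by
  have h : G.xi W = ∑ v, (G.xi W).1 v • G.xi {v} + ∑ e, (G.xi W).2 e • edgeVec e := by
    simp only [xi_singleton, edgeVec]
    ext x <;> simp [Prod.fst_sum, Prod.snd_sum, Pi.single_apply]
  rw [h, map_add, map_sum, map_sum, sum_eq_zero, sum_eq_zero, add_zero]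
  · intro e _
    by_cases hE : e ∈ G.edgeSet
    · simp [he e hE]
    · simp [xi, hE]
  · intro v _
    simp [hv v]

lemma starForm_xi_singleton (w v : V) (g : V → ℝ) :
    starForm w g (G.xi {v}) = if v = w then -2 else 0 := by
  rw [xi_singleton, starForm_apply]
  split_ifs with h
  · simp [h]
  · simp [Ne.symm h]

lemma starForm_edgeVec (w v : V) (g : V → ℝ) : starForm w g (edgeVec s(w, v)) = g v := by
  have h : ∀ u, g u * (Pi.single s(w, v) 1 : Sym2 V → ℝ) s(w, u) = if u = v then g u else 0 := by
    intro u
    have h' : u = v ∨ w = v ∧ u = w ↔ u = v := by grind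
    simp [Pi.single_apply, h']
  rw [starForm_apply, edgeVec]
  simp only [h]
  simp

end ExtendedIncidenceVectors

section OrbitInequalities

variable {V : Type*} [Fintype V] {G : SimpleGraph V} {w : V} {K : Finset V}

lemma mem_completeTo_insert {u : V} : u ∈ G.completeTo (insert w K) ↔
    u ∉ K ∧ G.Adj w u ∧ ∀ k ∈ K, G.Adj k u := by
  simp only [completeTo, mem_filter, mem_univ, true_and, mem_insert, not_or, forall_eq_or_imp,
    G.adj_comm u]
  refine ⟨fun h => ⟨h.1.2, h.2⟩, fun h => ⟨⟨h.2.1.ne', h.1⟩, h.2⟩⟩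

variable (G w K) in
/-- The edge coefficients of the inequality associated with `(w, K)`. -/
noncomputable def orbitCoeff (u : V) : ℝ :=
  if u ∈ K then 2 else if u ∈ G.completeTo (insert w K) then 1 else 0

variable (G w K) in
/-- The face of the induced path polytope defined by the inequality associated with `(w, K)`. -/
def orbitFace : Set ((V → ℝ) × (Sym2 V → ℝ)) :=
  {p ∈ G.inducedPathPolytope | starForm w (G.orbitCoeff w K) p = 0}

lemma starForm_orbitCoeff (p : (V → ℝ) × (Sym2 V → ℝ)) :
    starForm w (G.orbitCoeff w K) p = ∑ u ∈ G.completeTo (insert w K), p.2 s(w, u) +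
      2 * ∑ u ∈ K, p.2 s(w, u) - 2 * p.1 w := by
  have h : ∀ u, G.orbitCoeff w K u * p.2 s(w, u) =
      (if u ∈ G.completeTo (insert w K) then p.2 s(w, u) else 0) +
        (if u ∈ K then 2 * p.2 s(w, u) else 0) := by
    intro u
    by_cases hu : u ∈ K
    · have : u ∉ G.completeTo (insert w K) := fun h => (mem_completeTo_insert.1 h).1 hu
      simp [orbitCoeff, hu, this]
    · simp [orbitCoeff, hu]
  rw [starForm_apply, sum_congr rfl fun u _ => h u, sum_add_distrib]
  simp [mul_sum]

lemma setOf_orbit_eq_orbitFace : {p ∈ G.inducedPathPolytope |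
    ∑ u ∈ G.completeTo (insert w K), p.2 s(w, u) + 2 * ∑ u ∈ K, p.2 s(w, u) = 2 * p.1 w} =
      G.orbitFace w K := by
  ext p
  simp only [orbitFace, starForm_orbitCoeff, sub_eq_zero]

lemma xi_mem_orbitFace {W : Finset V} (hW : G.IsInducedPath W)
    (h : starForm w (G.orbitCoeff w K) (G.xi W) = 0) : G.xi W ∈ G.orbitFace w K :=
  ⟨xi_mem_inducedPathPolytope hW, h⟩

lemma xi_mem_orbitFace_of_notMem {W : Finset V} (hW : G.IsInducedPath W) (hw : w ∉ W) :
    G.xi W ∈ G.orbitFace w K :=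
  xi_mem_orbitFace hW (starForm_xi_of_notMem _ hw)

lemma xi_pair_mem_orbitFace {k : V} (hk : k ∈ K) (hwk : G.Adj w k) :
    G.xi {w, k} ∈ G.orbitFace w K := by
  refine xi_mem_orbitFace (isInducedPath_pair hwk) ?_
  simp [xi_pair hwk, starForm_xi_singleton, starForm_edgeVec, hwk.ne', orbitCoeff, hk]

lemma xi_triple_mem_orbitFace {u v : V} (hu : G.Adj w u) (hv : G.Adj w v) (huv : ¬ G.Adj u v)
    (hne : u ≠ v) (h : G.orbitCoeff w K u + G.orbitCoeff w K v = 2) :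
    G.xi {w, u, v} ∈ G.orbitFace w K := by
  refine xi_mem_orbitFace (isInducedPath_triple hu hv huv hne) ?_
  simp only [xi_triple hu hv huv hne, map_add, starForm_xi_singleton, starForm_edgeVec, hu.ne',
    hv.ne', if_true, if_false]
  linarith

lemma setDim_orbitFace :
    setDim (G.orbitFace w K) = Module.finrank ℝ (Submodule.span ℝ (G.orbitFace w K)) - 1 :=
  setDim_eq_finrank_span_sub_one (eulerForm V) fun _ hp => eulerForm_eq_one hp.1

lemma setDim_inducedPathPolytope : setDim G.inducedPathPolytope =
    Module.finrank ℝ (Submodule.span ℝ G.inducedPathPolytope) - 1 :=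
  setDim_eq_finrank_span_sub_one (eulerForm V) fun _ hp => eulerForm_eq_one hp

lemma xi_center_notMem_span_orbitFace : G.xi {w} ∉ Submodule.span ℝ (G.orbitFace w K) := by
  intro h
  have hle : Submodule.span ℝ (G.orbitFace w K) ≤
      LinearMap.ker (starForm w (G.orbitCoeff w K)) :=
    Submodule.span_le.2 fun p hp => hp.2
  have := hle h
  simp [starForm_xi_singleton] at this

variable (G w K) in
/-- The complement of the subgraph induced by the vertices complete to `insert w K`. -/
abbrev orbitCompl : SimpleGraph ((G.completeTo (insert w K) : Finset V) : Set V) :=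
  (G.induce ((G.completeTo (insert w K) : Finset V) : Set V))ᶜ

lemma colorable_two_of_adj_add_eq_zero {α : Type*} {H : SimpleGraph α} (b : α → ℝ)
    (hb : ∀ x y, H.Adj x y → b x + b y = 0) {x : α} (hx : b x ≠ 0) :
    (H.induce (H.connectedComponentMk x).supp).Colorable 2 := by
  have hne : ∀ y, H.Reachable x y → b y ≠ 0 := by
    rintro y ⟨p⟩
    induction p with
    | nil => exact hx
    | cons h p ih =>
      refine ih fun h0 => hx ?_
      have := hb _ _ h
      linarith
  have col : (H.induce (H.connectedComponentMk x).supp).Coloring Bool :=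
    Coloring.mk (fun y => decide (0 < b y)) (by
      rintro ⟨y, hy⟩ ⟨z, hz⟩ hyz
      have hy0 : b y ≠ 0 := hne y (ConnectedComponent.exact hy).symm
      have h := hb y z hyz
      rcases lt_or_gt_of_ne hy0 with h' | h'
      · have h1 : ¬ 0 < b y := by linarith
        have h2 : 0 < b z := by linarith
        simp [h1, h2]
      · have h1 : ¬ 0 < b z := by linarith
        simp [h1, h'])
  simpa using col.colorable

lemma span_inducedPathPolytope_le (hKN : (K : Set V) ⊆ G.neighborSet w)
    (hcol : ∀ c : (G.orbitCompl w K).ConnectedComponent,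
      ¬ ((G.orbitCompl w K).induce c.supp).Colorable 2) :
    Submodule.span ℝ G.inducedPathPolytope ≤
      Submodule.span ℝ (G.orbitFace w K) ⊔ Submodule.span ℝ {G.xi {w}} := by
  intro q hq
  by_contra hqM
  obtain ⟨f, hfq, hfM⟩ := Submodule.exists_le_ker_of_notMem hqM
  have hface : ∀ p ∈ G.orbitFace w K, f p = 0 := fun p hp =>
    hfM (Submodule.mem_sup_left (Submodule.subset_span hp))
  have hsingle : ∀ v, f (G.xi {v}) = 0 := by
    intro v
    by_cases hv : v = w
    · subst hv
      exact hfM (Submodule.mem_sup_right (Submodule.mem_span_singleton_self _))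
    · exact hface _ (xi_mem_orbitFace_of_notMem (isInducedPath_singleton v)
        (by simpa using Ne.symm hv))
  have hK : ∀ k ∈ K, f (edgeVec s(w, k)) = 0 := by
    intro k hk
    have h := hface _ (xi_pair_mem_orbitFace hk (hKN hk))
    simpa [xi_pair (hKN hk), hsingle] using h
  have htriple : ∀ u v, G.Adj w u → G.Adj w v → ¬ G.Adj u v → u ≠ v →
      G.orbitCoeff w K u + G.orbitCoeff w K v = 2 →
      f (edgeVec s(w, u)) + f (edgeVec s(w, v)) = 0 := by
    intro u v hu hv huv hne h2
    have h := hface _ (xi_triple_mem_orbitFace hu hv huv hne h2)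
    simpa [xi_triple hu hv huv hne, hsingle] using h
  have hC : ∀ u ∈ G.completeTo (insert w K), f (edgeVec s(w, u)) = 0 := by
    intro u hu
    by_contra hne
    refine hcol _ (colorable_two_of_adj_add_eq_zero (H := G.orbitCompl w K)
      (fun x => f (edgeVec s(w, (x : V)))) ?_ (x := ⟨u, hu⟩) hne)
    rintro ⟨x, hx⟩ ⟨y, hy⟩ hxy
    have hx' := mem_completeTo_insert.1 hx
    have hy' := mem_completeTo_insert.1 hy
    rw [compl_adj, comap_adj] at hxy
    refine htriple x y hx'.2.1 hy'.2.1 hxy.2 (fun h => hxy.1 (Subtype.ext h)) ?_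
    rw [orbitCoeff, orbitCoeff, if_neg hx'.1, if_neg hy'.1, if_pos (mem_coe.1 hx),
      if_pos (mem_coe.1 hy)]
    norm_num
  have hstar : ∀ u, G.Adj w u → f (edgeVec s(w, u)) = 0 := by
    intro u hu
    by_cases huK : u ∈ K
    · exact hK u huK
    by_cases huC : u ∈ G.completeTo (insert w K)
    · exact hC u huC
    obtain ⟨k, hk, hku⟩ : ∃ k ∈ K, ¬ G.Adj k u := by
      by_contra! h
      exact huC (mem_completeTo_insert.2 ⟨huK, hu, h⟩)
    have h := htriple k u (hKN hk) hu hku (fun h => huK (h ▸ hk))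
      (by simp [orbitCoeff, hk, huK, huC])
    rwa [hK k hk, zero_add] at h
  have hedge : ∀ e ∈ G.edgeSet, f (edgeVec e) = 0 := by
    intro e he
    induction e using Sym2.ind with
    | _ a b =>
      have hab : G.Adj a b := he
      by_cases ha : a = w
      · exact ha ▸ hstar b (ha ▸ hab)
      by_cases hb : b = w
      · rw [Sym2.eq_swap]
        exact hb ▸ hstar a (hb ▸ hab.symm)
      have h := hface _ (xi_mem_orbitFace_of_notMem (isInducedPath_pair hab)
        (by simp [Ne.symm ha, Ne.symm hb]))
      simpa [xi_pair hab, hsingle] using h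
  have hzero : G.inducedPathPolytope ⊆ LinearMap.ker f := by
    refine convexHull_min ?_ (LinearMap.ker f).convex
    rintro _ ⟨W, -, rfl⟩
    exact map_xi_eq_zero f hsingle hedge W
  exact hfq (Submodule.span_le.2 hzero hq)

lemma finrank_span_orbitFace_add_one (hKN : (K : Set V) ⊆ G.neighborSet w)
    (hcol : ∀ c : (G.orbitCompl w K).ConnectedComponent,
      ¬ ((G.orbitCompl w K).induce c.supp).Colorable 2) :
    Module.finrank ℝ (Submodule.span ℝ (G.orbitFace w K)) + 1 =
      Module.finrank ℝ (Submodule.span ℝ G.inducedPathPolytope) := by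
  rw [← Submodule.finrank_sup_span_singleton xi_center_notMem_span_orbitFace]
  have h : Submodule.span ℝ (G.orbitFace w K) ⊔ Submodule.span ℝ {G.xi {w}} =
      Submodule.span ℝ G.inducedPathPolytope :=
    le_antisymm
      (sup_le (Submodule.span_mono fun p hp => hp.1) (Submodule.span_mono
        (Set.singleton_subset_iff.2 (xi_mem_inducedPathPolytope (isInducedPath_singleton w)))))
      (span_inducedPathPolytope_le hKN hcol)
  rw [h]

/-- A signing of the vertices complete to `insert w K` that is opposite on non-adjacent vertices
gives a linear equation satisfied by the face. -/
lemma starForm_add_eq_zero_of_mem_orbitFace (hKc : G.IsClique (K : Set V)) {σ : V → ℝ}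
    (hσ : ∀ u, |σ u| ≤ 1) (hσ0 : ∀ u ∉ G.completeTo (insert w K), σ u = 0)
    (hσ2 : ∀ u ∈ G.completeTo (insert w K), ∀ v ∈ G.completeTo (insert w K), u ≠ v →
      ¬ G.Adj u v → σ u + σ v = 0) {p : (V → ℝ) × (Sym2 V → ℝ)} (hp : p ∈ G.orbitFace w K) :
    starForm w (G.orbitCoeff w K + σ) p = 0 := by
  have key : ∀ τ : V → ℝ, (∀ u, |τ u| ≤ 1) → (∀ u ∉ G.completeTo (insert w K), τ u = 0) →
      (∀ u ∈ G.completeTo (insert w K), ∀ v ∈ G.completeTo (insert w K), u ≠ v →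
        ¬ G.Adj u v → τ u + τ v = 0) → starForm w (G.orbitCoeff w K + τ) p ≤ 0 := by
    intro τ hτ hτ0 hτ2
    have hbound : ∀ u, (G.orbitCoeff w K + τ) u ≤ 2 := by
      intro u
      have h1 := (abs_le.1 (hτ u)).2
      by_cases huC : u ∈ G.completeTo (insert w K)
      · have := (mem_completeTo_insert.1 huC).1
        simp only [Pi.add_apply, orbitCoeff, this, huC, if_true, if_false]
        linarith
      · simp only [Pi.add_apply, hτ0 u huC, orbitCoeff, huC, if_false]
        split_ifs <;> norm_num
    have hout : ∀ u, u ∉ K → u ∉ G.completeTo (insert w K) →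
        (G.orbitCoeff w K + τ) u = 0 := by
      intro u hK hC
      simp [orbitCoeff, hK, hC, hτ0 u hC]
    refine starForm_nonpos hbound ?_ hp.1
    intro u v hu hv hne huv
    by_cases hu0 : u ∉ K ∧ u ∉ G.completeTo (insert w K)
    · linarith [hout u hu0.1 hu0.2, hbound v]
    by_cases hv0 : v ∉ K ∧ v ∉ G.completeTo (insert w K)
    · linarith [hout v hv0.1 hv0.2, hbound u]
    by_cases huK : u ∈ K
    · by_cases hvK : v ∈ K
      · exact absurd (hKc huK hvK hne) huv
      · have hvC : v ∈ G.completeTo (insert w K) := by tauto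
        exact absurd ((mem_completeTo_insert.1 hvC).2.2 u huK) huv
    · have huC : u ∈ G.completeTo (insert w K) := by tauto
      by_cases hvK : v ∈ K
      · exact absurd ((mem_completeTo_insert.1 huC).2.2 v hvK).symm huv
      · have hvC : v ∈ G.completeTo (insert w K) := by tauto
        have := hτ2 u huC v hvC hne huv
        simp only [Pi.add_apply, orbitCoeff, huK, hvK, huC, hvC, if_true, if_false]
        linarith
  have h1 := key σ hσ hσ0 hσ2
  have h2 := key (-σ) (fun u => by simpa using hσ u) (fun u hu => by simp [hσ0 u hu])
    (fun u hu v hv hne huv => by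
      have := hσ2 u hu v hv hne huv
      simp only [Pi.neg_apply]
      linarith)
  have h3 : starForm w (G.orbitCoeff w K + σ) p + starForm w (G.orbitCoeff w K + -σ) p =
      2 * starForm w (G.orbitCoeff w K) p := by
    simp only [starForm_apply, Pi.add_apply, Pi.neg_apply, add_mul, sum_add_distrib, neg_mul,
      sum_neg_distrib]
    ring
  have h4 : starForm w (G.orbitCoeff w K) p = 0 := hp.2
  linarith

/-- A proper `2`-coloring of a component, as a signing of the vertices. -/
lemma exists_signing_of_colorable_two {α : Type*} {H : SimpleGraph α} (c : H.ConnectedComponent)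
    (hc : (H.induce c.supp).Colorable 2) : ∃ σ : α → ℝ, (∀ x, |σ x| ≤ 1) ∧
      (∀ x y, H.Adj x y → σ x + σ y = 0) ∧ ∃ x, σ x ≠ 0 := by
  obtain ⟨col⟩ := hc
  refine ⟨fun x => if hx : x ∈ c.supp then (if col ⟨x, hx⟩ = 0 then 1 else -1) else 0,
    fun x => ?_, fun x y hxy => ?_, ?_⟩
  · dsimp only
    split_ifs <;> simp
  · by_cases hx : x ∈ c.supp
    · have hy : y ∈ c.supp := (c.mem_supp_congr_adj hxy).1 hx
      have hne : col ⟨x, hx⟩ ≠ col ⟨y, hy⟩ := col.valid (by simpa using hxy)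
      simp only [hx, hy, dif_pos]
      split_ifs <;> first | omega | norm_num
    · have hy : y ∉ c.supp := fun hy => hx ((c.mem_supp_congr_adj hxy).2 hy)
      simp [hx, hy]
  · obtain ⟨x, hx⟩ := c.nonempty_supp
    refine ⟨x, ?_⟩
    simp only [hx, dif_pos]
    split_ifs <;> norm_num

lemma finrank_span_orbitFace_add_two_le (hKc : G.IsClique (K : Set V))
    (c : (G.orbitCompl w K).ConnectedComponent)
    (hc : ((G.orbitCompl w K).induce c.supp).Colorable 2) :
    1 ≤ Module.finrank ℝ (Submodule.span ℝ (G.orbitFace w K)) ∧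
    Module.finrank ℝ (Submodule.span ℝ (G.orbitFace w K)) + 2 ≤
      Module.finrank ℝ (Submodule.span ℝ G.inducedPathPolytope) := by
  obtain ⟨σ₀, hσ₀, hσ₀adj, ⟨x, hxC⟩, hx⟩ := exists_signing_of_colorable_two c hc
  let σ : V → ℝ := fun u =>
    if hu : u ∈ ((G.completeTo (insert w K) : Finset V) : Set V) then σ₀ ⟨u, hu⟩ else 0
  have hσx : σ x ≠ 0 := by simpa only [σ, hxC, dif_pos] using hx
  have hwx : G.Adj w x := (mem_completeTo_insert.1 hxC).2.1
  have hface : ∀ p ∈ G.orbitFace w K, starForm w (G.orbitCoeff w K + σ) p = 0 := by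
    intro p hp
    refine starForm_add_eq_zero_of_mem_orbitFace hKc ?_ ?_ ?_ hp
    · intro u
      by_cases hu : u ∈ ((G.completeTo (insert w K) : Finset V) : Set V)
      · simpa only [σ, hu, dif_pos] using hσ₀ _
      · simp [σ, mem_coe.not.1 hu]
    · intro u hu
      simp [σ, hu]
    · intro u hu v hv hne huv
      have h := hσ₀adj ⟨u, hu⟩ ⟨v, hv⟩
        ((compl_adj _ _ _).2 ⟨fun h => hne (congrArg Subtype.val h), huv⟩)
      simpa [σ, hu, hv] using h
  have hxface : G.xi {x} ∈ G.orbitFace w K :=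
    xi_mem_orbitFace_of_notMem (isInducedPath_singleton x) (by simpa using hwx.ne)
  constructor
  · refine Submodule.one_le_finrank_iff.2 fun h => ?_
    have h0 := (Submodule.mem_bot ℝ).1 (h ▸ Submodule.subset_span hxface)
    have := congrFun (congrArg Prod.fst h0) x
    simp [xi] at this
  have hlt : Submodule.span ℝ (G.orbitFace w K) ⊔ Submodule.span ℝ {G.xi {w}} <
      Submodule.span ℝ G.inducedPathPolytope := by
    refine lt_of_le_of_ne (sup_le (Submodule.span_mono fun p hp => hp.1)
      (Submodule.span_mono (by
        simpa using xi_mem_inducedPathPolytope (isInducedPath_singleton w)))) fun heq => ?_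
    let f := starForm w (G.orbitCoeff w K + σ) - starForm w (G.orbitCoeff w K)
    have hle : Submodule.span ℝ (G.orbitFace w K) ⊔ Submodule.span ℝ {G.xi {w}} ≤
        LinearMap.ker f := by
      refine sup_le (Submodule.span_le.2 fun p hp => ?_) (Submodule.span_le.2 ?_)
      · have h2 : starForm w (G.orbitCoeff w K) p = 0 := hp.2
        simp [f, hface p hp, h2]
      · simp [f, starForm_xi_singleton]
    have hmem : G.xi {w, x} ∈ Submodule.span ℝ G.inducedPathPolytope :=
      Submodule.subset_span (xi_mem_inducedPathPolytope (isInducedPath_pair hwx))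
    have h0 := hle (heq ▸ hmem)
    simp only [f, LinearMap.mem_ker, LinearMap.sub_apply, xi_pair hwx, map_add,
      starForm_xi_singleton, starForm_edgeVec, Pi.add_apply] at h0
    exact hσx (by linarith)
  have h1 := Submodule.finrank_lt_finrank_of_lt hlt
  rw [Submodule.finrank_sup_span_singleton xi_center_notMem_span_orbitFace] at h1
  omega

end OrbitInequalities

end SimpleGraph

/-- the inequality associated with `(w, K)` defines a facet of the induced
path polytope iff no connected component of the complement of the subgraph induced on
`C_G(K ∪ {w})` is bipartite. -/
theorem facet_characterization {V : Type*} [Fintype V] (G : SimpleGraph V)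
    (hG : G.Chordal) (w : V) (K : Finset V)
    (hKN : (K : Set V) ⊆ G.neighborSet w) (hKc : G.IsClique (K : Set V)) :
    (setDim {p ∈ G.inducedPathPolytope |
        ∑ u ∈ G.completeTo (insert w K), p.2 s(w, u) +
          2 * ∑ u ∈ K, p.2 s(w, u) = 2 * p.1 w} =
      setDim G.inducedPathPolytope - 1) ↔
    ∀ c : ((G.induce ((G.completeTo (insert w K) : Finset V) : Set V))ᶜ).ConnectedComponent,
      ¬ (((G.induce ((G.completeTo (insert w K) : Finset V) : Set V))ᶜ).induce
          c.supp).Colorable 2 := by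
  rw [setOf_orbit_eq_orbitFace, setDim_orbitFace, setDim_inducedPathPolytope]
  constructor
  · intro h c hc
    have := finrank_span_orbitFace_add_two_le hKc c hc
    omega
  · intro h
    have := finrank_span_orbitFace_add_one hKN h
    omega
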